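/- Let L ∈ ℒ and let ϑ : ℕ → ℕ satisfy the Gaussian condition with respect to L. Then the supremum, over all functions f : ℕ → ℂ with ‖f‖∞ ≤ 1, of | E_{n≤N} f(ϑ(n)) − E^{2bin}_{n≤L(N)} f(n) | tends to 0 as N → ∞. -/

import Mathlib

open Filter Finset

/-- Discrete derivative: `ΔW(N) = W(N) - W(N-1)` for `N ≥ 2`, and `ΔW(1) = W(1)`. -/
noncomputable def dd (W : ℕ → ℝ) (N : ℕ) : ℝ := if 2 ≤ N then W N - W (N - 1) else W 1

/-- Weighted average `E^W_{n ≤ N} f(n) = (1/W(N)) ∑_{n=1}^N ΔW(n) f(n)`. -/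
noncomputable def wAvg (W : ℕ → ℝ) (f : ℕ → ℂ) (N : ℕ) : ℂ :=
  (1 / (W N : ℂ)) * ∑ n ∈ Finset.Icc 1 N, (dd W n : ℂ) * f n

/-- Cesàro average `E_{n ≤ N} f(n) = (1/N) ∑_{n=1}^N f(n)`. -/
noncomputable def cesaro (f : ℕ → ℂ) (N : ℕ) : ℂ :=
  (1 / (N : ℂ)) * ∑ n ∈ Finset.Icc 1 N, f n

/-- Parity-neutral binomial mean. -/
noncomputable def e2bin (f : ℕ → ℂ) (N : ℕ) : ℂ :=
  (1 / 2 ^ (N + 1) : ℂ) * ∑ n ∈ Finset.Icc 1 (2 * N), (Nat.choose N (n / 2) : ℂ) * f n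

/-- Binomial mean. -/
noncomputable def ebin (f : ℕ → ℂ) (N : ℕ) : ℂ :=
  (1 / 2 ^ N : ℂ) * ∑ n ∈ Finset.Icc 1 N, (Nat.choose N n : ℂ) * f n

/-- The class 𝒲: eventually non-decreasing nonnegative functions tending to ∞. -/
def memW (W : ℕ → ℝ) : Prop :=
  (∀ n, 0 ≤ W n) ∧ (∃ N₀ : ℕ, ∀ m n : ℕ, N₀ ≤ m → m ≤ n → W m ≤ W n) ∧
    Tendsto W atTop atTop

/-- The class 𝒲*: members of 𝒲 for which `N·Δ²W(N)/ΔW(N)` converges in `ℝ ∪ {±∞}`. -/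
def memWstar (W : ℕ → ℝ) : Prop :=
  memW W ∧ ∃ l : EReal,
    Tendsto (fun N : ℕ => (((N : ℝ) * dd (dd W) N / dd W N : ℝ) : EReal)) atTop (nhds l)

/-- The class ℒ: members of 𝒲 (with values in ℕ) whose discrete derivative is
eventually in {0,1}. -/
def memL (L : ℕ → ℕ) : Prop :=
  memW (fun n => (L n : ℝ)) ∧
    ∃ N₀ : ℕ, ∀ n : ℕ, N₀ ≤ n → L n = L (n - 1) ∨ L n = L (n - 1) + 1

/-- Gaussian probability density with mean μ and standard deviation σ. -/
noncomputable def gauss (x μ σ : ℝ) : ℝ :=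
  (1 / (σ * Real.sqrt (2 * Real.pi))) * Real.exp (-(x - μ) ^ 2 / (2 * σ ^ 2))

/-- The Gaussian condition \eqref{gaussian_condition}. -/
def gaussCond (ϑ : ℕ → ℕ) (L : ℕ → ℕ) : Prop :=
  Tendsto (fun N : ℕ => ∑' k : ℕ,
      |(((Finset.Icc 1 N).filter (fun n => ϑ n = k + 1)).card : ℝ) / N -
        gauss (k + 1 : ℝ) (L N) (Real.sqrt (L N))|) atTop (nhds 0)

/-- Ω(n): number of prime factors with multiplicity. -/
def bigOmega (n : ℕ) : ℕ := n.primeFactorsList.length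

/-- ω(n): number of distinct prime factors. -/
def smallOmega (n : ℕ) : ℕ := n.primeFactors.card

/-- Uniform distribution mod 1. -/
def udMod1 (x : ℕ → ℝ) : Prop :=
  ∀ a b : ℝ, 0 ≤ a → a < b → b ≤ 1 →
    Tendsto (fun N : ℕ =>
        (((Finset.Icc 1 N).filter
            (fun n => a ≤ Int.fract (x n) ∧ Int.fract (x n) < b)).card : ℝ) / N)
      atTop (nhds (b - a))

theorem one_add_le_exp_cubic (u : ℝ) :
    1 + u ≤ Real.exp (u - u ^ 2 / 2 + u ^ 3 / 3) := by
  set g : ℝ → ℝ := fun x => (1 + x) * Real.exp (-(x - x ^ 2 / 2 + x ^ 3 / 3)) with hg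
  have hd : ∀ x : ℝ, HasDerivAt g (-x ^ 3 * Real.exp (-(x - x ^ 2 / 2 + x ^ 3 / 3))) x := by
    intro x
    have h1 : HasDerivAt (fun x : ℝ => x - x ^ 2 / 2 + x ^ 3 / 3) (1 - x + x ^ 2) x := by
      have := ((hasDerivAt_id x).sub ((hasDerivAt_pow 2 x).div_const 2)).add
        ((hasDerivAt_pow 3 x).div_const 3)
      convert! this using 1
      norm_num
    have h2 := ((hasDerivAt_id x).const_add 1).mul h1.neg.exp
    convert! h2 using 1
    simp only [Pi.neg_apply, id]
    ring
  have hc : Continuous g := continuous_iff_continuousAt.2 fun x => (hd x).continuousAt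
  have hle : g u ≤ g 0 := by
    rcases le_total u 0 with h | h
    · refine monotoneOn_of_deriv_nonneg (convex_Iic (0 : ℝ)) hc.continuousOn
        (fun x _ => (hd x).differentiableAt.differentiableWithinAt) (fun x hx => ?_) h
        (Set.mem_Iic.2 le_rfl) h
      rw [interior_Iic, Set.mem_Iio] at hx
      rw [(hd x).deriv]
      have : 0 ≤ -x ^ 3 := by
        have := pow_nonneg (neg_nonneg.2 hx.le) 3
        linarith [neg_pow x 3]
      positivity
    · refine antitoneOn_of_deriv_nonpos (convex_Ici (0 : ℝ)) hc.continuousOn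
        (fun x _ => (hd x).differentiableAt.differentiableWithinAt) (fun x hx => ?_)
        (Set.mem_Ici.2 le_rfl) h h
      rw [interior_Ici, Set.mem_Ioi] at hx
      rw [(hd x).deriv, neg_mul]
      exact neg_nonpos.2 (by positivity)
  simp only [hg, Real.exp_neg] at hle
  rw [← div_eq_mul_inv, div_le_iff₀ (Real.exp_pos _)] at hle
  simpa using hle

theorem mul_pow_mul_pow_le_exp {k l : ℕ} (h : 0 < k + l) :
    (2 * k / (k + l : ℝ)) ^ k * (2 * l / (k + l : ℝ)) ^ l ≤
      Real.exp ((k - l : ℝ) ^ 2 / (2 * (k + l)) + (k - l : ℝ) ^ 4 / (3 * (k + l) ^ 3)) := by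
  have hN : (0 : ℝ) < k + l := by exact_mod_cast h
  have hk0 : (0 : ℝ) ≤ k := k.cast_nonneg
  have hl0 : (0 : ℝ) ≤ l := l.cast_nonneg
  set u : ℝ := (k - l) / (k + l) with hu
  have e1 : 2 * k / (k + l : ℝ) = 1 + u := by rw [hu]; field_simp; ring
  have e2 : 2 * l / (k + l : ℝ) = 1 + -u := by rw [hu]; field_simp; ring
  have p1 : 0 ≤ 1 + u := by rw [← e1]; positivity
  have p2 : 0 ≤ 1 + -u := by rw [← e2]; positivity
  rw [e1, e2]
  refine (mul_le_mul (pow_le_pow_left₀ p1 (one_add_le_exp_cubic _) k)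
    (pow_le_pow_left₀ p2 (one_add_le_exp_cubic _) l) (by positivity)
    (by positivity)).trans (le_of_eq ?_)
  rw [← Real.exp_nat_mul, ← Real.exp_nat_mul, ← Real.exp_add]
  congr 1
  rw [hu]
  field_simp
  ring

theorem factorial_eq_stirlingSeq_mul {n : ℕ} (hn : n ≠ 0) :
    (n.factorial : ℝ) = Stirling.stirlingSeq n * (√(2 * n) * (n / Real.exp 1) ^ n) := by
  have : (0 : ℝ) < n := by positivity
  rw [Stirling.stirlingSeq, div_mul_cancel₀]
  positivity

theorem stirlingSeq_le_of_le {m n : ℕ} (hm : 0 < m) (h : m ≤ n) :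
    Stirling.stirlingSeq n ≤ Stirling.stirlingSeq m := by
  obtain ⟨m, rfl⟩ := Nat.exists_eq_add_one.2 hm
  obtain ⟨n, rfl⟩ := Nat.exists_eq_add_one.2 (hm.trans_le h)
  exact Stirling.stirlingSeq'_antitone (by omega : m ≤ n)

theorem stirlingSeq_pos {m : ℕ} (hm : 0 < m) : 0 < Stirling.stirlingSeq m := by
  obtain ⟨m, rfl⟩ := Nat.exists_eq_add_one.2 hm
  exact Stirling.stirlingSeq'_pos m

theorem choose_lower_bound {k l m : ℕ} (hm : 0 < m) (hk : m ≤ k) (hl : m ≤ l) :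
    Real.pi / Stirling.stirlingSeq m ^ 2 *
      (1 / (√(k + l : ℝ) * √(2 * Real.pi)) *
        Real.exp (-((k - l : ℝ) ^ 2 / (2 * (k + l)) + (k - l : ℝ) ^ 4 / (3 * (k + l) ^ 3)))) ≤
      ((k + l).choose k : ℝ) / 2 ^ (k + l + 1) := by
  have hk0 : 0 < k := hm.trans_le hk
  have hl0 : 0 < l := hm.trans_le hl
  have hkr : (0 : ℝ) < k := by exact_mod_cast hk0
  have hlr : (0 : ℝ) < l := by exact_mod_cast hl0
  set s := Stirling.stirlingSeq m
  have hs0 : 0 < s := stirlingSeq_pos hm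
  set E := Real.exp ((k - l : ℝ) ^ 2 / (2 * (k + l)) + (k - l : ℝ) ^ 4 / (3 * (k + l) ^ 3)) with hE
  have hE0 : 0 < E := Real.exp_pos _
  rw [Real.exp_neg, ← hE]
  have hpow := mul_pow_mul_pow_le_exp (k := k) (l := l) (by omega)
  rw [← hE] at hpow
  have fk : (k.factorial : ℝ) ≤ s * (√(2 * k) * (k / Real.exp 1) ^ k) := by
    rw [factorial_eq_stirlingSeq_mul hk0.ne']
    gcongr
    exact stirlingSeq_le_of_le hm hk
  have fl : (l.factorial : ℝ) ≤ s * (√(2 * l) * (l / Real.exp 1) ^ l) := by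
    rw [factorial_eq_stirlingSeq_mul hl0.ne']
    gcongr
    exact stirlingSeq_le_of_le hm hl
  have fN : √(2 * Real.pi * (k + l : ℝ)) * ((k + l : ℝ) / Real.exp 1) ^ (k + l) ≤
      ((k + l).factorial : ℝ) := by
    exact_mod_cast Stirling.le_factorial_stirling (k + l)
  have hch : ((k + l).choose k : ℝ) * (k.factorial * l.factorial) = (k + l).factorial := by
    have := Nat.choose_mul_factorial_mul_factorial (Nat.le_add_right k l)
    rw [Nat.add_sub_cancel_left, mul_assoc] at this
    exact_mod_cast this
  have hsq : √(2 * k : ℝ) * √(2 * l) ≤ k + l := by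
    rw [← Real.sqrt_mul (by positivity)]
    apply Real.sqrt_le_iff.2 ⟨by positivity, ?_⟩
    nlinarith [sq_nonneg (k - l : ℝ)]
  set C := ((k + l).choose k : ℝ)
  have hC : 0 ≤ C := Nat.cast_nonneg _
  have key : √(2 * Real.pi * (k + l : ℝ)) * ((k + l : ℝ) / Real.exp 1) ^ (k + l) ≤
      C * (s ^ 2 * (k + l) * (((k + l : ℝ) / Real.exp 1) ^ (k + l) / 2 ^ (k + l) * E)) := by
    calc _ ≤ C * (k.factorial * l.factorial) := by rw [hch]; exact fN
      _ ≤ C * ((s * (√(2 * k) * (k / Real.exp 1) ^ k)) *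
          (s * (√(2 * l) * (l / Real.exp 1) ^ l))) := by
        gcongr
      _ = C * (s ^ 2 * (√(2 * k) * √(2 * l)) * (((k + l : ℝ) / Real.exp 1) ^ (k + l) / 2 ^ (k + l) *
          ((2 * k / (k + l : ℝ)) ^ k * (2 * l / (k + l : ℝ)) ^ l))) := by
        have h1 : ∀ x : ℝ, x / Real.exp 1 = (k + l : ℝ) / Real.exp 1 / 2 * (2 * x / (k + l)) := by
          intro x; field_simp
        rw [h1 k, h1 l, mul_pow, mul_pow, ← div_pow, pow_add]
        ring
      _ ≤ _ := by gcongr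
  have hA : 0 < ((k + l : ℝ) / Real.exp 1) ^ (k + l) := by positivity
  have key2 : √(2 * Real.pi * (k + l : ℝ)) * 2 ^ (k + l) ≤ C * s ^ 2 * (k + l) * E := by
    have : √(2 * Real.pi * (k + l : ℝ)) ≤ C * s ^ 2 * (k + l) * E / 2 ^ (k + l) := by
      refine le_of_mul_le_mul_right (key.trans (le_of_eq ?_)) hA
      ring
    rwa [le_div_iff₀ (by positivity)] at this
  rw [Real.sqrt_mul (by positivity)] at key2
  have q1 : √(2 * Real.pi) ^ 2 = 2 * Real.pi := Real.sq_sqrt (by positivity)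
  have q2 : √(k + l : ℝ) ^ 2 = k + l := Real.sq_sqrt (by positivity)
  set a := √(2 * Real.pi)
  set b := √(k + l : ℝ)
  have ha : 0 < a := by positivity
  have hb : 0 < b := by positivity
  rw [← q2] at key2
  have key3 : a * 2 ^ (k + l) ≤ C * s ^ 2 * b * E := by
    refine le_of_mul_le_mul_right (?_ : _ * b ≤ _ * b) hb
    linarith
  have : Real.pi = a ^ 2 / 2 := by rw [q1]; ring
  rw [this, le_div_iff₀ (by positivity), pow_succ (2 : ℝ) (k + l)]
  have : a ^ 2 / 2 / s ^ 2 * (1 / (b * a) * E⁻¹) * (2 ^ (k + l) * 2) =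
    (a * 2 ^ (k + l)) / (s ^ 2 * b * E) := by field_simp
  rw [this, div_le_iff₀ (by positivity)]
  linarith

theorem summable_exp_neg_mul_int_sq {c : ℝ} (hc : 0 < c) :
    Summable fun n : ℤ => Real.exp (-c * (n : ℝ) ^ 2) := by
  have hnat : Summable fun n : ℕ => Real.exp (-c * (n : ℝ) ^ 2) := by
    refine Summable.of_nonneg_of_le (fun _ => (Real.exp_pos _).le) (fun n => ?_)
      (Real.summable_exp_nat_mul_iff.2 (neg_lt_zero.2 hc))
    have : (n : ℝ) ≤ (n : ℝ) ^ 2 := by exact_mod_cast Nat.le_self_pow two_ne_zero n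
    exact Real.exp_le_exp.2 (by nlinarith)
  exact Summable.of_nat_of_neg (by simpa using hnat) (by simpa using hnat)

theorem tsum_exp_neg_int_sq_div {N : ℝ} (hN : 0 < N) :
    ∑' n : ℤ, Real.exp (-(n : ℝ) ^ 2 / N) =
      √(Real.pi * N) * ∑' n : ℤ, Real.exp (-(Real.pi ^ 2 * N) * (n : ℝ) ^ 2) := by
  have h := Real.tsum_exp_neg_mul_int_sq (a := 1 / (Real.pi * N)) (by positivity)
  rw [← Real.sqrt_eq_rpow, Real.sqrt_div zero_le_one, Real.sqrt_one, one_div_one_div] at h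
  convert h using 4 with n n
  · field_simp
  · field_simp

theorem sqrt_pi_mul_le_tsum_exp {N : ℝ} (hN : 0 < N) :
    √(Real.pi * N) ≤ ∑' n : ℤ, Real.exp (-(n : ℝ) ^ 2 / N) := by
  rw [tsum_exp_neg_int_sq_div hN]
  refine le_mul_of_one_le_right (Real.sqrt_nonneg _) ?_
  have := (summable_exp_neg_mul_int_sq (c := Real.pi ^ 2 * N) (by positivity)).le_tsum 0
    fun _ _ => (Real.exp_pos _).le
  simpa using this

theorem exists_tsum_exp_le :
    ∃ B : ℝ, ∀ N : ℝ, 1 ≤ N → ∑' n : ℤ, Real.exp (-(n : ℝ) ^ 2 / (4 * N)) ≤ B * √N := by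
  refine ⟨√(Real.pi * 4) * ∑' n : ℤ, Real.exp (-(Real.pi ^ 2) * (n : ℝ) ^ 2), fun N hN => ?_⟩
  have hN0 : 0 < N := by linarith
  rw [tsum_exp_neg_int_sq_div (by positivity), ← mul_assoc, Real.sqrt_mul (by positivity),
    mul_right_comm]
  gcongr
  · exact summable_exp_neg_mul_int_sq (by positivity)
  · exact summable_exp_neg_mul_int_sq (by positivity)
  · nlinarith [sq_nonneg Real.pi]

theorem summable_gauss {N : ℝ} (hN : 0 < N) (μ : ℤ) :
    Summable fun n : ℤ => Real.exp (-((n : ℝ) - μ) ^ 2 / N) := by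
  have h := summable_exp_neg_mul_int_sq (c := 1 / N) (by positivity)
  rw [← (Equiv.subRight μ).summable_iff] at h
  convert h using 2 with n
  simp [Function.comp]
  ring

theorem tsum_int_shift (g : ℤ → ℝ) (μ : ℤ) : ∑' n : ℤ, g (n - μ) = ∑' n : ℤ, g n :=
  (Equiv.subRight μ).tsum_eq g

theorem sum_range_two_mul_half {M : Type*} [AddCommMonoid M] (g : ℕ → M) (m : ℕ) :
    ∑ n ∈ range (2 * m), g (n / 2) = 2 • ∑ k ∈ range m, g k := by
  induction m with
  | zero => simp
  | succ m ih =>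
    rw [show 2 * (m + 1) = 2 * m + 1 + 1 by ring, sum_range_succ, sum_range_succ, ih,
      sum_range_succ, show (2 * m + 1) / 2 = m by omega, show 2 * m / 2 = m by omega, smul_add,
      two_nsmul (g m), add_assoc]

theorem error_mul_exp_le {N : ℝ} (hN : 1 ≤ N) (t : ℝ) :
    ((2 * |t| + 1) / (2 * N) + 8 * (t ^ 4 + 1) / (3 * N ^ 3)) * Real.exp (-t ^ 2 / (4 * N)) ≤
      100 / √N := by
  set r := √N with hr
  have hr1 : 1 ≤ r := Real.one_le_sqrt.2 hN
  have hr0 : 0 < r := by linarith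
  have hN2 : N = r ^ 2 := (Real.sq_sqrt (by linarith)).symm
  set y := |t| / (2 * r) with hy
  have hy0 : 0 ≤ y := by positivity
  have hty : |t| = 2 * r * y := by rw [hy]; field_simp
  have ht2 : t ^ 2 = 4 * r ^ 2 * y ^ 2 := by rw [← sq_abs, hty]; ring
  have ht4 : t ^ 4 = 16 * r ^ 4 * y ^ 4 := by
    rw [show t ^ 4 = (t ^ 2) ^ 2 by ring, ht2]; ring
  have hexp : -t ^ 2 / (4 * N) = -y ^ 2 := by rw [ht2, hN2]; field_simp
  rw [hexp, hty, ht4, hN2]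
  set w := Real.exp (-y ^ 2) with hw
  have hw0 : 0 < w := Real.exp_pos _
  have hw1 : w ≤ 1 := Real.exp_le_one_iff.2 (by nlinarith [sq_nonneg y])
  have hwi : w * Real.exp (y ^ 2) = 1 := by rw [hw, ← Real.exp_add]; simp
  have hq := Real.quadratic_le_exp_of_nonneg (sq_nonneg y)
  have h1 : y * w ≤ 1 := by
    rw [← hwi, mul_comm]
    gcongr
    nlinarith [sq_nonneg (y - 1), sq_nonneg (y ^ 2)]
  have h4 : y ^ 4 * w ≤ 2 := by
    have : y ^ 4 ≤ 2 * Real.exp (y ^ 2) := by nlinarith [sq_nonneg y]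
    calc y ^ 4 * w ≤ 2 * Real.exp (y ^ 2) * w := by gcongr
      _ = 2 * (w * Real.exp (y ^ 2)) := by ring
      _ = 2 := by rw [hwi, mul_one]
  have e : ((2 * (2 * r * y) + 1) / (2 * r ^ 2) +
      8 * (16 * r ^ 4 * y ^ 4 + 1) / (3 * (r ^ 2) ^ 3)) * w =
      (4 * r * (y * w) + w) / (2 * r ^ 2) +
        8 * (16 * r ^ 4 * (y ^ 4 * w) + w) / (3 * (r ^ 2) ^ 3) := by ring
  rw [e]
  calc _ ≤ (4 * r * 1 + 1) / (2 * r ^ 2) + 8 * (16 * r ^ 4 * 2 + 1) / (3 * (r ^ 2) ^ 3) := by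
        gcongr
    _ ≤ (4 * r * 1 + r) / (2 * r ^ 2) + 8 * (16 * r ^ 4 * 2 + r ^ 4) / (3 * (r ^ 2) ^ 3) := by
        gcongr
        exact one_le_pow₀ hr1
    _ = 5 / 2 / r + 88 / r / r := by field_simp; ring
    _ ≤ 5 / 2 / r + 88 / r := by gcongr; exact div_le_self (by positivity) hr1
    _ ≤ _ := by rw [← add_div]; gcongr; norm_num

/-- The weights of the parity-neutral binomial mean, extended by zero to all integers. -/
noncomputable def binWeight (N : ℕ) (n : ℤ) : ℝ :=
  if 1 ≤ n ∧ n ≤ 2 * N then (N.choose (n.toNat / 2) : ℝ) / 2 ^ (N + 1) else 0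

theorem binWeight_nonneg (N : ℕ) (n : ℤ) : 0 ≤ binWeight N n := by
  unfold binWeight
  split_ifs <;> positivity

theorem pi_div_stirlingSeq_sq_le_one {m : ℕ} (hm : 0 < m) :
    Real.pi / Stirling.stirlingSeq m ^ 2 ≤ 1 := by
  have h := Stirling.sqrt_pi_le_stirlingSeq hm.ne'
  rw [div_le_one (by have := stirlingSeq_pos hm; positivity)]
  exact Real.sqrt_le_left (stirlingSeq_pos hm).le |>.1 h

theorem gauss_natCast_sqrt (x : ℝ) (N : ℕ) :
    gauss x N (√N) =
      1 / (√N * √(2 * Real.pi)) * Real.exp (-(x - N) ^ 2 / (4 * N)) ^ 2 := by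
  rw [gauss, Real.sq_sqrt N.cast_nonneg, ← Real.exp_nat_mul]
  congr 2
  push_cast
  rcases eq_or_ne (N : ℝ) 0 with h | h
  · simp [h]
  · field_simp
    ring

theorem shifted_exponent_le {N : ℝ} (hN : 0 < N) {t v : ℝ} (h : v = t ∨ v = t - 1) :
    v ^ 2 / (2 * N) + v ^ 4 / (3 * N ^ 3) ≤
      t ^ 2 / (2 * N) + ((2 * |t| + 1) / (2 * N) + 8 * (t ^ 4 + 1) / (3 * N ^ 3)) := by
  rw [← add_assoc, ← add_div]
  have ht4 : 0 ≤ t ^ 4 := by positivity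
  rcases h with rfl | rfl
  · gcongr
    · nlinarith [abs_nonneg v]
    · linarith
  · gcongr
    · nlinarith [neg_abs_le t]
    · nlinarith [sq_nonneg (t ^ 2 - 1), sq_nonneg (t + 1), sq_nonneg (t ^ 2 + 2 * t + 1),
        sq_nonneg (t ^ 2 - 2 * t - 1), sq_nonneg (t ^ 2 + t + 1), sq_nonneg (t - 1)]

theorem gauss_sub_binWeight_le {N : ℕ} (hN : 4 ≤ N) (n : ℤ) :
    gauss n N (√N) - binWeight N n ≤
      ((1 - Real.pi / Stirling.stirlingSeq (N / 4) ^ 2) + 100 / √N) *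
        (1 / (√N * √(2 * Real.pi)) * Real.exp (-((n : ℝ) - N) ^ 2 / (4 * N))) := by
  have hm : 0 < N / 4 := by omega
  have hN0 : (0 : ℝ) < N := by exact_mod_cast (by omega : 0 < N)
  have hN1 : (1 : ℝ) ≤ N := by exact_mod_cast (by omega : 1 ≤ N)
  rw [gauss_natCast_sqrt]
  set c := Real.pi / Stirling.stirlingSeq (N / 4) ^ 2 with hc
  have hc1 : c ≤ 1 := pi_div_stirlingSeq_sq_le_one hm
  have hc0 : 0 ≤ c := by positivity
  set A := 1 / (√(N : ℝ) * √(2 * Real.pi)) with hA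
  have hA0 : 0 ≤ A := by positivity
  set t : ℝ := (n : ℝ) - N with ht
  set w := Real.exp (-t ^ 2 / (4 * N)) with hw
  have hw0 : 0 < w := Real.exp_pos _
  have hw1 : w ≤ 1 := by
    refine Real.exp_le_one_iff.2 (div_nonpos_of_nonpos_of_nonneg ?_ (by positivity))
    nlinarith [sq_nonneg t]
  by_cases hwin : ((N / 4 : ℕ) : ℤ) ≤ n / 2 ∧ n / 2 + (N / 4 : ℕ) ≤ N
  · obtain ⟨k, hk⟩ := Int.eq_ofNat_of_zero_le (show 0 ≤ n / 2 by omega)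
    obtain ⟨l, rfl⟩ : ∃ l, N = k + l := ⟨N - k, by omega⟩
    have hb := choose_lower_bound hm (k := k) (l := l) (by omega) (by omega)
    rw [binWeight, if_pos (by omega), show n.toNat / 2 = k by omega]
    have hv : (k - l : ℝ) = t ∨ (k - l : ℝ) = t - 1 := by
      have : (k - l : ℤ) = n - (k + l : ℕ) ∨ (k - l : ℤ) = n - (k + l : ℕ) - 1 := by
        push_cast; omega
      rw [ht]
      exact_mod_cast this
    have hx := shifted_exponent_le hN0 hv
    have herr := error_mul_exp_le hN1 t
    rw [← hw] at herr
    set x := (2 * |t| + 1) / (2 * ((k + l : ℕ) : ℝ)) + 8 * (t ^ 4 + 1) / (3 * ((k + l : ℕ) : ℝ) ^ 3)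
    have hx0 : 0 ≤ x := by positivity
    have hexp : w ^ 2 * (1 - x) ≤
        Real.exp (-((k - l : ℝ) ^ 2 / (2 * (k + l)) + (k - l : ℝ) ^ 4 / (3 * (k + l) ^ 3))) := by
      have h1 : w ^ 2 * (1 - x) ≤ w ^ 2 * Real.exp (-x) := by
        gcongr
        linarith [Real.add_one_le_exp (-x)]
      refine h1.trans ?_
      rw [hw, ← Real.exp_nat_mul, ← Real.exp_add]
      apply Real.exp_le_exp.2
      have : ((2 : ℕ) : ℝ) * (-t ^ 2 / (4 * ((k + l : ℕ) : ℝ))) =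
        - (t ^ 2 / (2 * ((k + l : ℕ) : ℝ))) := by push_cast; field_simp; ring
      rw [this]
      push_cast at hx ⊢
      linarith
    have hp : c * (A * (w ^ 2 * (1 - x))) ≤ ((k + l).choose k : ℝ) / 2 ^ (k + l + 1) := by
      refine le_trans ?_ hb
      rw [hA, hc]
      push_cast
      gcongr
    have h2 : A * w ^ 2 - c * (A * (w ^ 2 * (1 - x))) =
        (1 - c) * (A * w) * w + c * (A * w) * (x * w) := by ring
    have h3 : (1 - c) * (A * w) * w ≤ (1 - c) * (A * w) :=
      mul_le_of_le_one_right (mul_nonneg (by linarith) (by positivity)) hw1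
    have h4 : c * (A * w) * (x * w) ≤ 1 * (A * w) * (100 / √((k + l : ℕ) : ℝ)) := by gcongr
    linarith
  · have hp := binWeight_nonneg N n
    have htN : (N : ℝ) / 2 ≤ |t| := by
      have : (N : ℤ) ≤ 2 * (n - N) ∨ (N : ℤ) ≤ -(2 * (n - N)) := by omega
      have : (N : ℝ) ≤ 2 * t ∨ (N : ℝ) ≤ -(2 * t) := by rw [ht]; exact_mod_cast this
      rcases this with h | h
      · exact le_trans (by linarith) (le_abs_self t)
      · exact le_trans (by linarith) (neg_le_abs t)
    have ht2 : (N : ℝ) ^ 2 / 4 ≤ t ^ 2 := by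
      rw [← sq_abs t]
      nlinarith
    have hw2 : w ≤ 16 / N := by
      have h1 : (N : ℝ) / 16 ≤ t ^ 2 / (4 * N) := by
        rw [le_div_iff₀ (by positivity)]
        nlinarith
      have h2 : (N : ℝ) / 16 ≤ Real.exp (t ^ 2 / (4 * N)) :=
        h1.trans ((by linarith : _ ≤ t ^ 2 / (4 * N) + 1).trans (Real.add_one_le_exp _))
      rw [hw, neg_div, Real.exp_neg, ← inv_div (N : ℝ) 16]
      exact inv_anti₀ (by positivity) h2
    have hw3 : w ≤ 100 / √(N : ℝ) := by
      refine hw2.trans ?_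
      gcongr
      · norm_num
      · exact Real.sqrt_le_iff.2 ⟨hN0.le, by nlinarith⟩
    have h3 : A * w ^ 2 ≤ (100 / √(N : ℝ)) * (A * w) := by
      have : w * (A * w) ≤ (100 / √(N : ℝ)) * (A * w) := by gcongr
      linarith
    have h4 : 0 ≤ (1 - c) * (A * w) := mul_nonneg (by linarith) (by positivity)
    linarith

theorem summable_gauss_int {N : ℕ} (hN : 0 < N) : Summable fun n : ℤ => gauss n N (√N) := by
  have := (summable_gauss (N := 2 * N) (by positivity) (N : ℤ)).mul_left
    (1 / (√N * √(2 * Real.pi)))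
  simpa [gauss, Real.sq_sqrt N.cast_nonneg] using this

theorem one_le_tsum_gauss {N : ℕ} (hN : 0 < N) : 1 ≤ ∑' n : ℤ, gauss n N (√N) := by
  have hN0 : (0 : ℝ) < N := by exact_mod_cast hN
  have hshift := tsum_int_shift (fun n => Real.exp (-(n : ℝ) ^ 2 / (2 * N))) N
  push_cast at hshift
  have hle := sqrt_pi_mul_le_tsum_exp (N := 2 * N) (by positivity)
  simp only [gauss, Real.sq_sqrt N.cast_nonneg, tsum_mul_left]
  rw [hshift, one_div_mul_eq_div, one_le_div (by positivity), ← Real.sqrt_mul hN0.le]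
  rwa [show (N : ℝ) * (2 * Real.pi) = Real.pi * (2 * N) by ring]

theorem summable_binWeight (N : ℕ) : Summable fun n : ℤ => binWeight N n := by
  refine summable_of_hasFiniteSupport ((Set.finite_Icc (1 : ℤ) (2 * N)).subset fun n hn => ?_)
  by_contra h
  exact hn (if_neg h)

theorem binWeight_eq_zero_of_le {N k : ℕ} (hk : 2 * N ≤ k) : binWeight N ((k : ℤ) + 1) = 0 :=
  if_neg (by omega)

theorem binWeight_natCast_succ {N k : ℕ} (hk : k < 2 * N) :
    binWeight N ((k : ℤ) + 1) = (N.choose ((k + 1) / 2) : ℝ) / 2 ^ (N + 1) := by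
  rw [binWeight, if_pos (by omega)]
  rfl

theorem tsum_binWeight_eq_sum {N K : ℕ} (hK : 2 * N ≤ K) :
    ∑' n : ℤ, binWeight N n = ∑ k ∈ range K, binWeight N ((k : ℤ) + 1) := by
  have hinj : Function.Injective fun k : ℕ => (k : ℤ) + 1 := fun a b h => by simpa using h
  rw [← hinj.tsum_eq]
  · refine tsum_eq_sum fun k hk => binWeight_eq_zero_of_le ?_
    rw [mem_range] at hk
    omega
  · intro n hn
    have : 1 ≤ n := by
      by_contra h
      exact hn (if_neg fun h' => h h'.1)
    exact ⟨(n - 1).toNat, by simp; omega⟩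

theorem tsum_binWeight_le_one (N : ℕ) : ∑' n : ℤ, binWeight N n ≤ 1 := by
  rw [tsum_binWeight_eq_sum le_rfl,
    sum_congr rfl fun k hk => binWeight_natCast_succ (mem_range.1 hk), ← sum_div,
    div_le_one (by positivity)]
  have h := sum_range_two_mul_half (fun k => N.choose k) (N + 1)
  rw [Nat.sum_range_choose, show 2 * (N + 1) = 2 * N + 1 + 1 by ring, sum_range_succ,
    sum_range_succ'] at h
  have : ∑ k ∈ range (2 * N), N.choose ((k + 1) / 2) ≤ 2 ^ (N + 1) := by
    rw [pow_succ']
    simp only [smul_eq_mul] at h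
    omega
  exact_mod_cast this

/-- The rate at which the parity-neutral binomial weights approach the Gaussian density. -/
noncomputable def gaussError (N : ℕ) : ℝ :=
  (1 - Real.pi / Stirling.stirlingSeq (N / 4) ^ 2) + 100 / √N

theorem gaussError_nonneg {N : ℕ} (hN : 4 ≤ N) : 0 ≤ gaussError N :=
  add_nonneg (sub_nonneg.2 (pi_div_stirlingSeq_sq_le_one (by omega))) (by positivity)

theorem tendsto_gaussError : Tendsto gaussError atTop (nhds 0) := by
  have h1 : Tendsto (fun N : ℕ => Stirling.stirlingSeq (N / 4)) atTop (nhds (√Real.pi)) :=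
    Stirling.tendsto_stirlingSeq_sqrt_pi.comp (Nat.tendsto_div_const_atTop (by norm_num))
  have h2 : Tendsto (fun N : ℕ => 100 / √(N : ℝ)) atTop (nhds 0) :=
    (Real.tendsto_sqrt_atTop.comp tendsto_natCast_atTop_atTop).const_div_atTop 100
  have h3 := ((tendsto_const_nhds (x := Real.pi)).div (h1.pow 2) (by positivity)).const_sub 1
    |>.add h2
  rw [Real.sq_sqrt Real.pi_pos.le, div_self Real.pi_ne_zero] at h3
  rwa [sub_self, add_zero] at h3

theorem exists_gauss_binWeight_bound :
    ∃ B : ℝ, ∀ N : ℕ, 4 ≤ N →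
      1 - gaussError N * B ≤ ∑' n : ℤ, binWeight N n ∧
      ∑' n : ℤ, |gauss n N (√N) - binWeight N n| ≤ 2 * (gaussError N * B) := by
  obtain ⟨B, hB⟩ := exists_tsum_exp_le
  refine ⟨B / √(2 * Real.pi), fun N hN => ?_⟩
  have hN0 : (0 : ℝ) < N := by exact_mod_cast (by omega : 0 < N)
  have hN1 : (1 : ℝ) ≤ N := by exact_mod_cast (by omega : 1 ≤ N)
  set W : ℤ → ℝ := fun n =>
    1 / (√N * √(2 * Real.pi)) * Real.exp (-((n : ℝ) - N) ^ 2 / (4 * N)) with hW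
  have hWs : Summable W := by
    have := (summable_gauss (N := 4 * N) (by positivity) (N : ℤ)).mul_left
      (1 / (√N * √(2 * Real.pi)))
    simpa [hW] using this
  have hWt : ∑' n, W n ≤ B / √(2 * Real.pi) := by
    have hshift := tsum_int_shift (fun n => Real.exp (-(n : ℝ) ^ 2 / (4 * N))) N
    push_cast at hshift
    rw [hW, tsum_mul_left, hshift]
    calc _ ≤ 1 / (√N * √(2 * Real.pi)) * (B * √N) := by gcongr; exact hB N hN1
      _ = _ := by field_simp
  have hE0 := gaussError_nonneg hN
  have hEW : ∑' n, gaussError N * W n ≤ gaussError N * (B / √(2 * Real.pi)) := by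
    rw [tsum_mul_left]
    gcongr
  have hg := summable_gauss_int (N := N) (by omega)
  have hg1 := one_le_tsum_gauss (N := N) (by omega)
  have hb := summable_binWeight N
  have hpt : ∀ n : ℤ, gauss n N (√N) - binWeight N n ≤ gaussError N * W n :=
    gauss_sub_binWeight_le hN
  have hEs := hWs.mul_left (gaussError N)
  constructor
  · have := (hg.sub hEs).tsum_le_tsum (fun n => by linarith [hpt n]) hb
    rw [hg.tsum_sub hEs] at this
    linarith
  · have hle : ∀ n : ℤ, |gauss n N (√N) - binWeight N n| ≤
        2 * (gaussError N * W n) - (gauss n N (√N) - binWeight N n) := by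
      intro n
      have h0 : 0 ≤ gaussError N * W n := by positivity
      refine abs_le'.2 ⟨?_, ?_⟩ <;> linarith [hpt n]
    have := (hg.sub hb).abs.tsum_le_tsum hle ((hEs.mul_left 2).sub (hg.sub hb))
    rw [(hEs.mul_left 2).tsum_sub (hg.sub hb), hg.tsum_sub hb, tsum_mul_left] at this
    linarith [tsum_binWeight_le_one N]

theorem e2bin_eq_sum (f : ℕ → ℂ) {N K : ℕ} (hK : 2 * N ≤ K) :
    e2bin f N = ∑ k ∈ range K, (binWeight N ((k : ℤ) + 1) : ℂ) * f (k + 1) := by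
  have hsub : range (2 * N) ⊆ range K := range_subset_range.2 hK
  have hIcc : Finset.Icc 1 (2 * N) = Finset.Ico (0 + 1) (2 * N + 1) := by
    ext
    simp only [Finset.mem_Icc, Finset.mem_Ico]
    omega
  rw [e2bin, ← sum_subset hsub fun k _ hk => by
    rw [binWeight_eq_zero_of_le (by simpa using hk)]; simp, mul_sum, hIcc, ← sum_Ico_add',
    ← range_eq_Ico]
  refine sum_congr rfl fun k hk => ?_
  rw [binWeight_natCast_succ (mem_range.1 hk)]
  push_cast
  ring

/-- The proportion of `1 ≤ n ≤ N` with `ϑ n = j`. -/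
noncomputable def freq (ϑ : ℕ → ℕ) (N j : ℕ) : ℝ :=
  (((Finset.Icc 1 N).filter (fun n => ϑ n = j)).card : ℝ) / N

theorem cesaro_eq_sum (f : ℕ → ℂ) {ϑ : ℕ → ℕ} {N K : ℕ} (hK : ∀ n ∈ Finset.Icc 1 N, ϑ n < K) :
    cesaro (fun n => f (ϑ n)) N = ∑ j ∈ range K, (freq ϑ N j : ℂ) * f j := by
  rw [cesaro, ← sum_fiberwise_of_maps_to' (fun n hn => mem_range.2 (hK n hn)) f, mul_sum]
  refine sum_congr rfl fun j _ => ?_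
  rw [sum_const, freq, nsmul_eq_mul]
  push_cast
  ring

theorem sum_freq {ϑ : ℕ → ℕ} {N K : ℕ} (hN : 0 < N) (hK : ∀ n ∈ Finset.Icc 1 N, ϑ n < K) :
    ∑ j ∈ range K, freq ϑ N j = 1 := by
  have h := cesaro_eq_sum (fun _ => 1) hK
  have hN' : (N : ℂ) ≠ 0 := by exact_mod_cast hN.ne'
  simp only [cesaro, sum_const, Nat.card_Icc, Nat.add_sub_cancel, nsmul_eq_mul, mul_one,
    one_div_mul_cancel hN'] at h
  exact_mod_cast h.symm

theorem norm_cesaro_sub_e2bin_le {f : ℕ → ℂ} (hf : ∀ n, ‖f n‖ ≤ 1) (ϑ : ℕ → ℕ) {N m : ℕ}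
    (hN : 0 < N) (hm : 0 < m) :
    ‖cesaro (fun n => f (ϑ n)) N - e2bin f m‖ ≤
      (1 - ∑' n : ℤ, binWeight m n) +
        2 * (∑' k : ℕ, |freq ϑ N (k + 1) - gauss (k + 1 : ℝ) m (√m)| +
          ∑' n : ℤ, |gauss n m (√m) - binWeight m n|) := by
  obtain ⟨K, hKm, hKϑ⟩ : ∃ K, 2 * m ≤ K ∧ ∀ n ∈ Finset.Icc 1 N, ϑ n < K + 1 :=
    ⟨2 * m + (Finset.Icc 1 N).sup ϑ, by omega,
      fun n hn => by have := Finset.le_sup (f := ϑ) hn; omega⟩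
  have hinj : Function.Injective fun k : ℕ => (k : ℤ) + 1 := fun a b h => by simpa using h
  have hg := summable_gauss_int hm
  have hgb := (hg.sub (summable_binWeight m)).abs
  have hfs : Summable fun k : ℕ => freq ϑ N (k + 1) := by
    refine summable_of_ne_finset_zero (s := range K) fun k hk => ?_
    have : (Finset.Icc 1 N).filter (fun n => ϑ n = k + 1) = ∅ :=
      filter_eq_empty_iff.2 fun n hn h => by
        have := hKϑ n hn
        rw [mem_range] at hk
        omega
    simp [freq, this]
  have hgN : Summable fun k : ℕ => gauss (k + 1 : ℝ) m (√m) := by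
    simpa [Function.comp_def] using hg.comp_injective hinj
  have h1 : ∑ k ∈ range K, |freq ϑ N (k + 1) - gauss (k + 1 : ℝ) m (√m)| ≤
      ∑' k : ℕ, |freq ϑ N (k + 1) - gauss (k + 1 : ℝ) m (√m)| :=
    (hfs.sub hgN).abs.sum_le_tsum _ fun _ _ => abs_nonneg _
  have h2 : ∑ k ∈ range K, |gauss (k + 1 : ℝ) m (√m) - binWeight m ((k : ℤ) + 1)| ≤
      ∑' n : ℤ, |gauss n m (√m) - binWeight m n| := by
    have := hgb.sum_le_tsum ((range K).map ⟨_, hinj⟩) fun _ _ => abs_nonneg _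
    simpa using this
  have h3 : ∑ k ∈ range K, |freq ϑ N (k + 1) - binWeight m ((k : ℤ) + 1)| ≤
      ∑ k ∈ range K, |freq ϑ N (k + 1) - gauss (k + 1 : ℝ) m (√m)| +
        ∑ k ∈ range K, |gauss (k + 1 : ℝ) m (√m) - binWeight m ((k : ℤ) + 1)| := by
    rw [← sum_add_distrib]
    exact sum_le_sum fun k _ => abs_sub_le _ _ _
  have h0 : freq ϑ N 0 ≤ (1 - ∑' n : ℤ, binWeight m n) +
      ∑ k ∈ range K, |freq ϑ N (k + 1) - binWeight m ((k : ℤ) + 1)| := by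
    have hs := sum_freq hN hKϑ
    rw [sum_range_succ'] at hs
    rw [tsum_binWeight_eq_sum hKm]
    have : ∑ k ∈ range K, binWeight m ((k : ℤ) + 1) - ∑ k ∈ range K, freq ϑ N (k + 1) ≤
        ∑ k ∈ range K, |freq ϑ N (k + 1) - binWeight m ((k : ℤ) + 1)| := by
      rw [← sum_sub_distrib]
      exact sum_le_sum fun k _ => by rw [abs_sub_comm]; exact le_abs_self _
    linarith
  have hdiff : cesaro (fun n => f (ϑ n)) N - e2bin f m = (freq ϑ N 0 : ℂ) * f 0 +
      ∑ k ∈ range K, ((freq ϑ N (k + 1) - binWeight m ((k : ℤ) + 1) : ℝ) : ℂ) * f (k + 1) := by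
    rw [cesaro_eq_sum f hKϑ, e2bin_eq_sum f hKm, sum_range_succ', add_comm, add_sub_assoc,
      ← sum_sub_distrib]
    push_cast
    simp only [sub_mul]
  have hfreq0 : 0 ≤ freq ϑ N 0 := by unfold freq; positivity
  have hnorm : ∀ (a : ℝ) (j : ℕ), ‖(a : ℂ) * f j‖ ≤ |a| := fun a j => by
    rw [norm_mul, Complex.norm_real, Real.norm_eq_abs]
    exact mul_le_of_le_one_right (abs_nonneg _) (hf j)
  rw [hdiff]
  have hA := hnorm (freq ϑ N 0) 0
  rw [abs_of_nonneg hfreq0] at hA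
  have hB := norm_sum_le_of_le (range K) fun k _ =>
    hnorm (freq ϑ N (k + 1) - binWeight m ((k : ℤ) + 1)) (k + 1)
  have := norm_add_le_of_le hA hB
  linarith

/-- Theorem 2.1 / part 1 of the main theorem.
If `L ∈ ℒ` and `ϑ` satisfies the Gaussian condition w.r.t. `L`, then uniformly over all
`f : ℕ → ℂ` with `‖f‖_∞ ≤ 1`, `E_{n≤N} f(ϑ(n)) = E^{2bin}_{n≤L(N)} f(n) + o(1)`. -/
theorem stmt0 (L : ℕ → ℕ) (ϑ : ℕ → ℕ) (hL : memL L) (hϑ : gaussCond ϑ L) :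
    ∀ ε : ℝ, 0 < ε → ∀ᶠ N : ℕ in atTop, ∀ f : ℕ → ℂ, (∀ n, ‖f n‖ ≤ 1) →
      ‖cesaro (fun n => f (ϑ n)) N - e2bin f (L N)‖ < ε := by
  intro ε hε
  obtain ⟨B, hB⟩ := exists_gauss_binWeight_bound
  have hLt : Tendsto L atTop atTop := tendsto_natCast_atTop_iff.1 hL.1.2.2
  have hlim : Tendsto (fun N => gaussError (L N) * B) atTop (nhds 0) := by
    simpa using (tendsto_gaussError.comp hLt).mul_const B
  filter_upwards [hlim.eventually_lt_const (by linarith : 0 < ε / 10),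
    hϑ.eventually_lt_const (by linarith : 0 < ε / 4), hLt.eventually_ge_atTop 4,
    eventually_gt_atTop 0] with N hE hG hL4 hN f hf
  have h := norm_cesaro_sub_e2bin_le hf ϑ hN (m := L N) (by omega)
  obtain ⟨h1, h2⟩ := hB (L N) hL4
  simp only [freq] at h
  linarith
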